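/- Each of the four graphs — the butterfly, the bowtie, K₄, and K_{1,1,3} — is a minimal unsatisfiability graph: it is in 𝒰, and every finite simple graph that is a topological minor of it but not isomorphic to it is not in 𝒰. -/

import Mathlib

open SimpleGraph

namespace Sat2

abbrev Lit (V : Type) := V × Bool
abbrev TwoCNF (V : Type) := List (Lit V × Lit V)

/-- An assignment satisfies a 2-CNF if it satisfies at least one literal
of every clause. -/
def SatTwoCNF {V : Type} (τ : V → Bool) (S : TwoCNF V) : Prop :=
  ∀ c ∈ S, τ c.1.1 = c.1.2 ∨ τ c.2.1 = c.2.2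

def TwoSatisfiable {V : Type} (S : TwoCNF V) : Prop := ∃ τ, SatTwoCNF τ S

/-- The unordered pair of underlying variables of a 2-clause. -/
def clauseVars {V : Type} (c : Lit V × Lit V) : Sym2 V := s(c.1.1, c.2.1)

/-- A 2-CNF is simple if in every clause the two literals have distinct
underlying variables, and no two distinct clauses have the same unordered
pair of underlying variables. -/
def SimpleTwoCNF {V : Type} (S : TwoCNF V) : Prop :=
  (∀ c ∈ S, c.1.1 ≠ c.2.1) ∧ (S.map clauseVars).Nodup

/-- A 2-CNF `S` is supported on a simple graph `G` (with vertex type equal to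
the variable type) when clause ↦ unordered pair of variables is a bijection
from the clauses of `S` onto the edges of `G`. -/
def SupportedOn {V : Type} (S : TwoCNF V) (G : SimpleGraph V) : Prop :=
  (S.map clauseVars).Nodup ∧ {e : Sym2 V | e ∈ S.map clauseVars} = G.edgeSet

/-- `G ∈ 𝒰`: some unsatisfiable simple 2-CNF is supported on `G`. -/
def InU {V : Type} (G : SimpleGraph V) : Prop :=
  ∃ S : TwoCNF V, SimpleTwoCNF S ∧ SupportedOn S G ∧ ¬ TwoSatisfiable S

/-- `G` is isomorphic to a subgraph of `H`. -/
def IsSubgraphOf {α β : Type} (G : SimpleGraph α) (H : SimpleGraph β) : Prop :=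
  ∃ f : α → β, Function.Injective f ∧ ∀ ⦃u v⦄, G.Adj u v → H.Adj (f u) (f v)

/-- The graph obtained from `G` by subdividing the edge `(u, v)`:
the edge `(u,v)` is replaced by a path `u – w – v` through the
new vertex `w = none`. -/
def subdivideEdge {α : Type} (G : SimpleGraph α) (u v : α) :
    SimpleGraph (Option α) :=
  SimpleGraph.fromRel (fun a b =>
    match a, b with
    | some x, some y => G.Adj x y ∧ s(x, y) ≠ s(u, v)
    | some x, none => x = u ∨ x = v
    | _, _ => False)

/-- `IsSubdivision G H` : `H` is (up to starting isomorphism) obtained from `G`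
by repeatedly subdividing edges. -/
inductive IsSubdivision : {α β : Type} → SimpleGraph α → SimpleGraph β → Prop where
  | of_iso {α β : Type} {G : SimpleGraph α} {H : SimpleGraph β} :
      (G ≃g H) → IsSubdivision G H
  | step {α β : Type} {G : SimpleGraph α} {H : SimpleGraph β} (u v : β) :
      IsSubdivision G H → H.Adj u v → IsSubdivision G (subdivideEdge H u v)

/-- `G` is a topological minor of `H`: some subdivision of `G` is isomorphic
to a subgraph of `H`. -/
def IsTopMinor {α β : Type} (G : SimpleGraph α) (H : SimpleGraph β) : Prop :=
  ∃ (γ : Type) (G' : SimpleGraph γ), IsSubdivision G G' ∧ IsSubgraphOf G' H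

/-- Contraction of the edge `(u,v)`: delete `v` and merge it into `u`. -/
def contractEdge {α : Type} (G : SimpleGraph α) (u v : α) :
    SimpleGraph {w : α // w ≠ v} :=
  SimpleGraph.fromRel (fun a b =>
    G.Adj a.val b.val ∨ (a.val = u ∧ G.Adj v b.val) ∨ (b.val = u ∧ G.Adj a.val v))

/-- `ContractionSeq H G` : `G` can be obtained from `H` by a sequence of edge
contractions, each performed at an edge whose endpoints have no common
neighbor at the time of contraction. -/
inductive ContractionSeq : {α β : Type} → SimpleGraph α → SimpleGraph β → Prop where
  | of_iso {α β : Type} {H : SimpleGraph α} {G : SimpleGraph β} :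
      (H ≃g G) → ContractionSeq H G
  | step {α β : Type} {H : SimpleGraph α} {G : SimpleGraph β} (u v : α) :
      H.Adj u v → (∀ w, ¬(H.Adj u w ∧ H.Adj v w)) →
      ContractionSeq (contractEdge H u v) G → ContractionSeq H G

/-- The butterfly graph: two triangles sharing exactly one vertex. -/
def butterfly : SimpleGraph (Fin 5) :=
  SimpleGraph.fromEdgeSet {s(0,1), s(0,2), s(1,2), s(2,3), s(2,4), s(3,4)}

/-- The bowtie graph: two vertex-disjoint triangles joined by a single edge. -/
def bowtie : SimpleGraph (Fin 6) :=
  SimpleGraph.fromEdgeSet {s(0,1), s(0,2), s(1,2), s(2,3), s(3,4), s(3,5), s(4,5)}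

/-- The complete graph on four vertices. -/
def K4 : SimpleGraph (Fin 4) := ⊤

/-- The complete tripartite graph `K_{1,1,3}`, with parts {0}, {1}, {2,3,4}. -/
def K113 : SimpleGraph (Fin 5) :=
  SimpleGraph.fromEdgeSet {s(0,1), s(0,2), s(0,3), s(0,4), s(1,2), s(1,3), s(1,4)}

/-- The complete graph on four vertices with one edge deleted. -/
def K4minusE : SimpleGraph (Fin 4) :=
  SimpleGraph.fromEdgeSet {s(0,1), s(0,2), s(0,3), s(1,2), s(1,3)}

/-- A finite simple graph is a minimal unsatisfiability graph if it is in `𝒰`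
and every finite simple graph that is a topological minor of it but not
isomorphic to it is not in `𝒰`. -/
def MinimalUnsatGraph {α : Type} (G : SimpleGraph α) : Prop :=
  InU G ∧ ∀ (β : Type) [Fintype β] (H : SimpleGraph β),
    IsTopMinor H G → IsEmpty (H ≃g G) → ¬ InU H

/-- Sign-function form of `InU`: `c u v` is the sign of `u` in the clause on the edge `uv`. -/
def HasUnsatSigning {V : Type} (G : SimpleGraph V) : Prop :=
  ∃ c : V → V → Bool, ∀ τ : V → Bool, ∃ u v, G.Adj u v ∧ τ u ≠ c u v ∧ τ v ≠ c v u

theorem InU.hasUnsatSigning {V : Type} {G : SimpleGraph V} (h : InU G) :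
    HasUnsatSigning G := by
  classical
  obtain ⟨S, ⟨hne, hnd⟩, ⟨-, hsupp⟩, hunsat⟩ := h
  have hinj := List.inj_on_of_nodup_map hnd
  refine ⟨fun u v => decide (∃ t, ((u, true), (v, t)) ∈ S ∨ ((v, t), (u, true)) ∈ S),
    fun τ => ?_⟩
  have hτ : ¬ SatTwoCNF τ S := fun h => hunsat ⟨τ, h⟩
  simp only [SatTwoCNF, not_forall, not_or] at hτ
  obtain ⟨⟨⟨u, s⟩, ⟨v, t⟩⟩, hc, hu, hv⟩ := hτ
  have huv : u ≠ v := hne _ hc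
  refine ⟨u, v, ?_, ?_, ?_⟩
  · rw [← mem_edgeSet, ← hsupp]
    exact List.mem_map_of_mem (f := clauseVars) hc
  · suffices hs : decide (∃ t, ((u, true), (v, t)) ∈ S ∨ ((v, t), (u, true)) ∈ S) = s by
      simpa only [hs] using hu
    cases s
    · rw [decide_eq_false_iff_not]
      rintro ⟨t', h | h⟩
      · simpa using hinj hc h rfl
      · exact huv (congrArg (·.1.1) (hinj hc h Sym2.eq_swap))
    · exact decide_eq_true ⟨t, Or.inl hc⟩
  · suffices ht : decide (∃ s, ((v, true), (u, s)) ∈ S ∨ ((u, s), (v, true)) ∈ S) = t by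
      simpa only [ht] using hv
    cases t
    · rw [decide_eq_false_iff_not]
      rintro ⟨s', h | h⟩
      · exact huv (congrArg (·.1.1) (hinj hc h Sym2.eq_swap))
      · simpa using hinj hc h rfl
    · exact decide_eq_true ⟨s, Or.inr hc⟩

theorem HasUnsatSigning.map {α β : Type} {G : SimpleGraph α} {H : SimpleGraph β}
    (hG : HasUnsatSigning G) {f : α → β} (hf : Function.Injective f)
    (hadj : ∀ u v, G.Adj u v → H.Adj (f u) (f v)) : HasUnsatSigning H := by
  obtain ⟨c, hc⟩ := hG
  have : Nonempty α := ⟨(hc fun _ => true).choose⟩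
  refine ⟨fun a b => c (Function.invFun f a) (Function.invFun f b), fun τ => ?_⟩
  obtain ⟨u, v, huv, hu, hv⟩ := hc (τ ∘ f)
  refine ⟨f u, f v, hadj u v huv, ?_, ?_⟩ <;>
    simpa only [Function.leftInverse_invFun hf _] using by assumption

theorem subdivideEdge_adj_some_some {α : Type} {G : SimpleGraph α} {u v x y : α} :
    (subdivideEdge G u v).Adj (some x) (some y) ↔ G.Adj x y ∧ s(x, y) ≠ s(u, v) := by
  simp only [subdivideEdge, fromRel_adj, ne_eq, Option.some.injEq, Sym2.eq_swap (a := y),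
    G.adj_comm y x, or_self, and_iff_right_iff_imp]
  exact fun h => h.1.ne

theorem subdivideEdge_adj_some_none {α : Type} {G : SimpleGraph α} {u v x : α} :
    (subdivideEdge G u v).Adj (some x) none ↔ x = u ∨ x = v := by
  simp [subdivideEdge]

theorem HasUnsatSigning.subdivideEdge {α : Type} {G : SimpleGraph α} (hG : HasUnsatSigning G)
    {u v : α} (huv : G.Adj u v) : HasUnsatSigning (subdivideEdge G u v) := by
  classical
  obtain ⟨c, hc⟩ := hG
  let c' : Option α → Option α → Bool
    | some x, some y => c x y
    | some x, none => if x = u then c u v else c v u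
    | none, some x => decide (x = u)
    | none, none => true
  refine ⟨c', fun τ => ?_⟩
  have hends (hu : τ (some u) ≠ c u v) (hv : τ (some v) ≠ c v u) :
      ∃ a b, (Sat2.subdivideEdge G u v).Adj a b ∧ τ a ≠ c' a b ∧ τ b ≠ c' b a := by
    cases h : τ none
    · exact ⟨some u, none, subdivideEdge_adj_some_none.2 (.inl rfl), by simpa [c'] using hu,
        by simp [c', h]⟩
    · exact ⟨some v, none, subdivideEdge_adj_some_none.2 (.inr rfl),
        by simpa [c', huv.ne'] using hv, by simp [c', h, huv.ne']⟩
  obtain ⟨x, y, hxy, hx, hy⟩ := hc (τ ∘ some)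
  by_cases he : s(x, y) = s(u, v)
  · rcases Sym2.eq_iff.1 he with ⟨rfl, rfl⟩ | ⟨rfl, rfl⟩
    · exact hends hx hy
    · exact hends hy hx
  · exact ⟨some x, some y, subdivideEdge_adj_some_some.2 ⟨hxy, he⟩, hx, hy⟩

theorem HasUnsatSigning.of_isSubdivision {α β : Type} {G : SimpleGraph α} {H : SimpleGraph β}
    (h : IsSubdivision G H) (hG : HasUnsatSigning G) : HasUnsatSigning H := by
  induction h with
  | of_iso e => exact hG.map e.injective fun u v => e.map_adj_iff.2
  | step u v _ huv ih => exact (ih hG).subdivideEdge huv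

/-- If every vertex can be charged with one incident edge so that all edges are charged,
then every signing is satisfied by letting each vertex satisfy its own clause. -/
theorem not_hasUnsatSigning_of_pointer {V : Type} {G : SimpleGraph V} (p : V → V)
    (hp : ∀ u v, G.Adj u v → p u = v ∨ p v = u) : ¬ HasUnsatSigning G := by
  rintro ⟨c, hc⟩
  obtain ⟨u, v, huv, hu, hv⟩ := hc fun u => c u (p u)
  rcases hp u v huv with rfl | rfl
  · exact hu rfl
  · exact hv rfl

/-- If every edge meets one of two hubs `a`, `b`, then each common neighbour of the hubs, and the
edge `ab`, forbids at most one pair of values of the hubs; three such constraints leave a pair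
free. -/
theorem not_hasUnsatSigning_of_hubs {V : Type} {G : SimpleGraph V} {a b : V} (hab : a ≠ b)
    (hcover : ∀ u v, G.Adj u v → u = a ∨ u = b ∨ v = a ∨ v = b)
    (hfew : (∃ x y, ∀ w, G.Adj a w → G.Adj b w → w = x ∨ w = y) ∨
      ¬ G.Adj a b ∧ ∃ x y z, ∀ w, G.Adj a w → G.Adj b w → w = x ∨ w = y ∨ w = z) :
    ¬ HasUnsatSigning G := by
  classical
  rintro ⟨c, hc⟩
  have hfree : ∀ p q r : Bool × Bool, ∃ m, m ≠ p ∧ m ≠ q ∧ m ≠ r := by decide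
  have hor : ∀ s t p q : Bool, (s, t) ≠ (!p, !q) → s = p ∨ t = q := by decide
  obtain ⟨⟨s, t⟩, hedge, hcommon⟩ : ∃ m : Bool × Bool,
      (G.Adj a b → m ≠ (!c a b, !c b a)) ∧
        ∀ w, G.Adj a w → G.Adj b w → m ≠ (!c a w, !c b w) := by
    rcases hfew with ⟨x, y, h⟩ | ⟨hnadj, x, y, z, h⟩
    · obtain ⟨m, h₁, h₂, h₃⟩ :=
        hfree (!c a b, !c b a) (!c a x, !c b x) (!c a y, !c b y)
      refine ⟨m, fun _ => h₁, fun w hw hw' => ?_⟩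
      rcases h w hw hw' with rfl | rfl <;> assumption
    · obtain ⟨m, h₁, h₂, h₃⟩ :=
        hfree (!c a x, !c b x) (!c a y, !c b y) (!c a z, !c b z)
      refine ⟨m, fun h => absurd h hnadj, fun w hw hw' => ?_⟩
      rcases h w hw hw' with rfl | rfl | rfl <;> assumption
  let τ : V → Bool := fun w =>
    if w = a then s else if w = b then t
    else if G.Adj a w ∧ s ≠ c a w then c w a else c w b
  have hτa : τ a = s := by simp [τ]
  have hτb : τ b = t := by simp [τ, hab.symm]
  have hsat_a (w : V) (hw : G.Adj a w) : τ a = c a w ∨ τ w = c w a := by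
    rw [hτa]
    by_cases hwb : w = b
    · subst hwb
      rw [hτb]
      exact hor _ _ _ _ (hedge hw)
    · by_cases hs : s = c a w
      · exact .inl hs
      · exact .inr (by simp [τ, hw.ne', hwb, hw, hs])
  have hsat_b (w : V) (hw : G.Adj b w) : τ b = c b w ∨ τ w = c w b := by
    by_cases hwa : w = a
    · subst hwa
      exact (hsat_a b hw.symm).symm
    · rw [hτb]
      by_cases ht : t = c b w
      · exact .inl ht
      · refine .inr ?_
        have hcond : ¬ (G.Adj a w ∧ s ≠ c a w) := by
          rintro ⟨haw, hs⟩
          exact (hor _ _ _ _ (hcommon w haw hw)).elim hs ht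
        simp only [τ, hwa, hw.ne', hcond, if_false]
  obtain ⟨u, v, huv, hu, hv⟩ := hc τ
  rcases hcover u v huv with rfl | rfl | rfl | rfl
  · exact (hsat_a v huv).elim hu hv
  · exact (hsat_b v huv).elim hu hv
  · exact (hsat_a u huv.symm).elim hv hu
  · exact (hsat_b u huv.symm).elim hv hu

/-- Minimality criterion: `G` has no isolated vertex, no vertex arising from a subdivision, and
deleting any edge leaves `𝒰`. -/
theorem minimalUnsatGraph_of_deleteEdges {α : Type} {G : SimpleGraph α} (hG : InU G)
    (hiso : ∀ x, ∃ y, G.Adj x y)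
    (hdeg : ∀ x a b, a ≠ b → G.Adj x a → G.Adj x b → (∀ y, G.Adj x y → y = a ∨ y = b) →
      G.Adj a b)
    (hdel : ∀ a b, G.Adj a b → ¬ HasUnsatSigning (G.deleteEdges {s(a, b)})) :
    MinimalUnsatGraph G := by
  refine ⟨hG, fun β _ H hminor hne hH => ?_⟩
  obtain ⟨γ, G', hsub, f, hf, hadj⟩ := hminor
  by_cases hsurj : ∀ a b, G.Adj a b → ∃ u v, G'.Adj u v ∧ f u = a ∧ f v = b
  · have hrefl (u v : γ) : G.Adj (f u) (f v) → G'.Adj u v := fun h => by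
      obtain ⟨u', v', h', hu, hv⟩ := hsurj _ _ h
      rwa [hf hu, hf hv] at h'
    have hfs : Function.Surjective f := fun x => by
      obtain ⟨y, hy⟩ := hiso x
      obtain ⟨u, v, -, hu, -⟩ := hsurj x y hy
      exact ⟨u, hu⟩
    cases hsub with
    | of_iso e =>
      exact hne.false (e.trans
        ⟨Equiv.ofBijective f ⟨hf, hfs⟩, fun {u v} => ⟨hrefl u v, fun h => hadj h⟩⟩)
    | step u v _ huv =>
      refine (subdivideEdge_adj_some_some.1 (hrefl (some u) (some v)
        (hdeg (f none) _ _ ?_ (hadj ?_) (hadj ?_) ?_))).2 rfl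
      · exact fun h => huv.ne (Option.some.inj (hf h))
      · exact (subdivideEdge_adj_some_none.2 (.inl rfl)).symm
      · exact (subdivideEdge_adj_some_none.2 (.inr rfl)).symm
      · intro y hy
        obtain ⟨_ | w, rfl⟩ := hfs y
        · exact (G.irrefl hy).elim
        · rcases subdivideEdge_adj_some_none.1 (hrefl _ _ hy).symm with rfl | rfl
          · exact .inl rfl
          · exact .inr rfl
  · push Not at hsurj
    obtain ⟨a, b, hab, h⟩ := hsurj
    refine hdel a b hab ((hH.hasUnsatSigning.of_isSubdivision hsub).map hf fun u v huv => ?_)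
    rw [deleteEdges_adj, Set.mem_singleton_iff, Sym2.eq_iff]
    refine ⟨hadj huv, ?_⟩
    rintro (⟨hu, hv⟩ | ⟨hu, hv⟩)
    · exact h u v huv hu hv
    · exact h v u huv.symm hv hu

theorem inU_of_list {V : Type} {G : SimpleGraph V} (S : TwoCNF V)
    (hnd : (S.map clauseVars).Nodup) (hsupp : ∀ u v, s(u, v) ∈ S.map clauseVars ↔ G.Adj u v)
    (hunsat : ¬ TwoSatisfiable S) : InU G := by
  refine ⟨S, ⟨fun c hc => ?_, hnd⟩, ⟨hnd, ?_⟩, hunsat⟩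
  · exact ((hsupp _ _).1 (List.mem_map_of_mem (f := clauseVars) hc)).ne
  · ext e
    induction e with | _ u v => exact hsupp u v

instance : DecidableRel butterfly.Adj := fun u v =>
  decidable_of_iff (s(u, v) ∈ ({s(0,1), s(0,2), s(1,2), s(2,3), s(2,4), s(3,4)} :
    Finset (Sym2 (Fin 5))) ∧ u ≠ v) (by simp [butterfly])

instance : DecidableRel bowtie.Adj := fun u v =>
  decidable_of_iff (s(u, v) ∈ ({s(0,1), s(0,2), s(1,2), s(2,3), s(3,4), s(3,5), s(4,5)} :
    Finset (Sym2 (Fin 6))) ∧ u ≠ v) (by simp [bowtie])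

instance : DecidableRel K4.Adj := inferInstanceAs (DecidableRel (⊤ : SimpleGraph (Fin 4)).Adj)

instance : DecidableRel K113.Adj := fun u v =>
  decidable_of_iff (s(u, v) ∈ ({s(0,1), s(0,2), s(0,3), s(0,4), s(1,2), s(1,3), s(1,4)} :
    Finset (Sym2 (Fin 5))) ∧ u ≠ v) (by simp [K113])

theorem inU_butterfly : InU butterfly := by
  refine inU_of_list [((2, true), (0, true)), ((0, false), (1, true)), ((1, false), (2, true)),
    ((2, false), (3, true)), ((3, false), (4, true)), ((4, false), (2, false))]
    (by decide) (by decide) ?_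
  rintro ⟨τ, h⟩
  simp [SatTwoCNF] at h
  grind

theorem inU_bowtie : InU bowtie := by
  refine inU_of_list [((2, true), (0, true)), ((0, false), (1, true)), ((1, false), (2, true)),
    ((3, true), (4, true)), ((4, false), (5, true)), ((5, false), (3, true)),
    ((2, false), (3, false))] (by decide) (by decide) ?_
  rintro ⟨τ, h⟩
  simp [SatTwoCNF] at h
  grind

theorem inU_K4 : InU K4 := by
  refine inU_of_list [((0, true), (1, true)), ((0, true), (2, true)), ((0, false), (3, true)),
    ((1, false), (2, false)), ((1, true), (3, false)), ((2, true), (3, false))]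
    (by decide) (by decide) ?_
  rintro ⟨τ, h⟩
  simp [SatTwoCNF] at h
  grind

theorem inU_K113 : InU K113 := by
  refine inU_of_list [((0, true), (1, true)), ((0, true), (2, true)), ((1, false), (2, false)),
    ((0, false), (3, true)), ((1, true), (3, false)), ((0, false), (4, true)),
    ((1, false), (4, false))] (by decide) (by decide) ?_
  rintro ⟨τ, h⟩
  simp [SatTwoCNF] at h
  grind

theorem butterfly_deleteEdges (a b : Fin 5) (hab : butterfly.Adj a b) :
    ¬ HasUnsatSigning (butterfly.deleteEdges {s(a, b)}) := by
  obtain ⟨p, hp⟩ : ∃ p : Fin 5 → Fin 5, ∀ u v, butterfly.Adj u v ∧ s(u, v) ≠ s(a, b) →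
      p u = v ∨ p v = u := by
    have key : ∀ a b, butterfly.Adj a b →
        ∃ p ∈ [![2, 2, 3, 4, 2], ![1, 2, 3, 4, 2], ![2, 0, 3, 4, 2],
            ![1, 2, 0, 2, 2], ![1, 2, 0, 4, 2], ![1, 2, 0, 2, 3]],
          ∀ u v : Fin 5, butterfly.Adj u v ∧ s(u, v) ≠ s(a, b) → p u = v ∨ p v = u := by
      decide
    obtain ⟨p, -, hp⟩ := key a b hab
    exact ⟨p, hp⟩
  exact not_hasUnsatSigning_of_pointer p fun u v h => hp u v (deleteEdges_adj.1 h)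

theorem bowtie_deleteEdges (a b : Fin 6) (hab : bowtie.Adj a b) :
    ¬ HasUnsatSigning (bowtie.deleteEdges {s(a, b)}) := by
  obtain ⟨p, hp⟩ : ∃ p : Fin 6 → Fin 6, ∀ u v, bowtie.Adj u v ∧ s(u, v) ≠ s(a, b) →
      p u = v ∨ p v = u := by
    have key : ∀ a b, bowtie.Adj a b →
        ∃ p ∈ [![2, 2, 3, 4, 5, 3], ![1, 2, 3, 4, 5, 3], ![2, 0, 3, 4, 5, 3],
            ![1, 2, 0, 4, 5, 3], ![1, 2, 0, 2, 3, 3], ![1, 2, 0, 2, 5, 3], ![1, 2, 0, 2, 3, 4]],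
          ∀ u v : Fin 6, bowtie.Adj u v ∧ s(u, v) ≠ s(a, b) → p u = v ∨ p v = u := by
      decide
    obtain ⟨p, -, hp⟩ := key a b hab
    exact ⟨p, hp⟩
  exact not_hasUnsatSigning_of_pointer p fun u v h => hp u v (deleteEdges_adj.1 h)

theorem K4_deleteEdges (a b : Fin 4) (hab : K4.Adj a b) :
    ¬ HasUnsatSigning (K4.deleteEdges {s(a, b)}) := by
  have key : ∀ a b : Fin 4, a ≠ b → ∃ x y, x ≠ y ∧ ∀ w, w = x ∨ w = y ∨ w = a ∨ w = b := by
    decide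
  obtain ⟨x, y, hxy, h⟩ := key a b hab.ne
  refine not_hasUnsatSigning_of_hubs hxy (fun u v huv => ?_)
    (.inl ⟨a, b, fun w hx hy => ?_⟩)
  · rw [deleteEdges_adj, Set.mem_singleton_iff, Sym2.eq_iff] at huv
    have hu := h u
    have hv := h v
    have := huv.1.ne
    grind
  · have hw := h w
    have := hx.ne
    have := hy.ne
    grind

theorem K113_deleteEdges (a b : Fin 5) (hab : K113.Adj a b) :
    ¬ HasUnsatSigning (K113.deleteEdges {s(a, b)}) := by
  have hcover : ∀ u v, K113.Adj u v → u = 0 ∨ u = 1 ∨ v = 0 ∨ v = 1 := by decide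
  refine not_hasUnsatSigning_of_hubs (a := 0) (b := 1) (by decide)
    (fun u v h => hcover u v (deleteEdges_adj.1 h).1) ?_
  simp only [deleteEdges_adj, Set.mem_singleton_iff]
  revert a b
  decide

/-- Each of the butterfly, the bowtie, `K₄` and `K_{1,1,3}` is a minimal
unsatisfiability graph. -/
theorem stmt_17 : MinimalUnsatGraph butterfly ∧ MinimalUnsatGraph bowtie ∧
    MinimalUnsatGraph K4 ∧ MinimalUnsatGraph K113 :=
  ⟨minimalUnsatGraph_of_deleteEdges inU_butterfly (by decide) (by decide) butterfly_deleteEdges,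
    minimalUnsatGraph_of_deleteEdges inU_bowtie (by decide) (by decide) bowtie_deleteEdges,
    minimalUnsatGraph_of_deleteEdges inU_K4 (by decide) (by decide) K4_deleteEdges,
    minimalUnsatGraph_of_deleteEdges inU_K113 (by decide) (by decide) K113_deleteEdges⟩

end Sat2
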